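/- arXiv:1512.09249 — 4 statements merged into one kernel-verified Lean document; each statement's English description precedes it below -/
import Mathlib

section
/- Let k ≥ 3 be an integer. There is a constant C depending only on k such that for all real X ≥ 1: | −(1/2)·∑_{1 ≤ n < X} ∑_{d | n} min(d/√n, √n/d)^{k−1} − X/(1−k) | ≤ C·√X. (This is the contribution of the hyperbolic and unipotent conjugacy classes to the averaged Selberg trace formula.) -/
open MeasureTheory intervalIntegral

noncomputable def hh (m : ℕ) (u : ℝ) : ℝ := u ^ (-(m : ℝ) / 2)

lemma hh_one (m : ℕ) : hh m 1 = 1 := by simp [hh]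

lemma hh_anti (m : ℕ) {u v : ℝ} (hu : 0 < u) (huv : u ≤ v) : hh m v ≤ hh m u := by
  unfold hh
  apply Real.rpow_le_rpow_of_nonpos hu huv
  have : (0:ℝ) ≤ m := by positivity
  linarith

lemma hh_nonneg (m : ℕ) {u : ℝ} (hu : 0 ≤ u) : 0 ≤ hh m u := by
  unfold hh; positivity

lemma hh_cont (m : ℕ) : ContinuousOn (hh m) (Set.Ioi 0) := by
  unfold hh
  intro x hx
  exact (Real.continuousAt_rpow_const _ _ (Or.inl (ne_of_gt hx))).continuousWithinAt

lemma hh_ii (m : ℕ) {a b : ℝ} (ha : 0 < a) (hb : 0 < b) :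
    IntervalIntegrable (hh m) volume a b := by
  apply ContinuousOn.intervalIntegrable
  apply (hh_cont m).mono
  intro x hx
  rw [Set.mem_uIcc] at hx
  rw [Set.mem_Ioi]
  rcases hx with h | h <;> linarith

lemma hh_ii' (m : ℕ) {c a b : ℝ} (hc : 0 < c) (ha : 0 < a) (hb : 0 < b) :
    IntervalIntegrable (fun t => hh m (t / c)) volume a b := by
  apply ContinuousOn.intervalIntegrable
  apply (hh_cont m).comp (by fun_prop)
  intro x hx
  rw [Set.mem_uIcc] at hx
  rw [Set.mem_Ioi]
  apply div_pos _ hc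
  rcases hx with h | h <;> linarith

lemma inner_bound (m a : ℕ) (ha : 1 ≤ a) (X : ℝ) (hX : (a:ℝ)^2 < X) :
    |∑ b ∈ Finset.Ico (a+1) ⌈X / a⌉₊, hh m (b / a) - a * ∫ u in (1:ℝ)..(X / a^2), hh m u| ≤ 1 := by
  have ha0 : (0:ℝ) < a := by exact_mod_cast ha
  have hlt : (a:ℝ) < X / a := by rw [lt_div_iff₀ ha0]; nlinarith
  have hC : a < ⌈X / a⌉₊ := Nat.lt_ceil.mpr hlt
  obtain ⟨B, hB⟩ : ∃ B, ⌈X / a⌉₊ = B + 1 := ⟨⌈X / a⌉₊ - 1, by omega⟩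
  have hB1 : (B:ℝ) < X / a := Nat.lt_ceil.mp (by omega)
  have hB2 : X / a ≤ ((B + 1 : ℕ) : ℝ) := by rw [← hB]; exact Nat.le_ceil _
  have haB : a ≤ B := by omega
  have haB' : (a:ℝ) ≤ B := by exact_mod_cast haB
  rw [hB]
  have anti : ∀ c : ℝ, AntitoneOn (fun t => hh m (t / a)) (Set.Icc (a:ℝ) c) := by
    intro c x hx y hy hxy
    have : 0 < x := lt_of_lt_of_le ha0 hx.1
    exact hh_anti m (by positivity) (by gcongr)
  have hint : (a:ℝ) * ∫ u in (1:ℝ)..(X / a^2), hh m u = ∫ t in (a:ℝ)..(X/a), hh m (t / a) := by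
    rw [intervalIntegral.integral_comp_div (hh m) ha0.ne', div_self ha0.ne', smul_eq_mul,
      div_div, ← sq]
  rw [hint]
  have h1 := AntitoneOn.sum_le_integral_Ico haB (anti B)
  have h2 := AntitoneOn.integral_le_sum_Ico (show a ≤ B + 1 by omega) (anti ((B+1:ℕ):ℝ))
  have hBpos : (0:ℝ) < B := by linarith
  have hXa : 0 < X / a := by linarith
  have hB3 : (0:ℝ) < ((B+1:ℕ):ℝ) := by positivity
  have nn : ∀ p q : ℝ, 0 < p → p ≤ q → 0 ≤ ∫ t in p..q, hh m (t / a) := by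
    intro p q hp hpq
    apply intervalIntegral.integral_nonneg hpq
    intro u hu
    apply hh_nonneg
    have : 0 < u := lt_of_lt_of_le hp hu.1
    positivity
  have e1 := integral_add_adjacent_intervals (hh_ii' m ha0 ha0 hBpos) (hh_ii' m ha0 hBpos hXa)
  have e2 := integral_add_adjacent_intervals (hh_ii' m ha0 ha0 hXa) (hh_ii' m ha0 hXa hB3)
  have n1 := nn _ _ hBpos hB1.le
  have n2 := nn _ _ hXa hB2
  have s1 : ∑ i ∈ Finset.Ico a B, hh m (((i+1:ℕ):ℝ) / a)
      = ∑ b ∈ Finset.Ico (a+1) (B+1), hh m (b / a) := by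
    rw [← Finset.sum_Ico_add' (fun b : ℕ => hh m (b / a)) a B 1]
  have s2 : ∑ i ∈ Finset.Ico a (B+1), hh m ((i:ℝ) / a)
      = 1 + ∑ b ∈ Finset.Ico (a+1) (B+1), hh m (b / a) := by
    rw [Finset.sum_eq_sum_Ico_succ_bot (by omega), div_self ha0.ne', hh_one]
  rw [s1] at h1
  rw [s2] at h2
  rw [abs_le]
  constructor <;> linarith

lemma A_bound (X u : ℝ) (hu : 1 < u) (huX : u ≤ X) :
    |∑ a ∈ Finset.Ico 1 ⌈√X⌉₊, (if u ≤ X / (a:ℝ)^2 then (a:ℝ) else 0) - X / (2 * u)|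
      ≤ √(X/u) := by
  have hX : 0 < X := by linarith
  have hu0 : 0 < u := by linarith
  set y := √(X/u) with hy
  have hy2 : y^2 = X/u := Real.sq_sqrt (by positivity)
  have hy0 : 0 ≤ y := Real.sqrt_nonneg _
  have hyX : y < √X := by
    apply Real.sqrt_lt_sqrt (by positivity)
    rw [div_lt_iff₀ hu0]; nlinarith
  have hs : ∑ a ∈ Finset.Ico 1 ⌈√X⌉₊, (if u ≤ X / (a:ℝ)^2 then (a:ℝ) else 0)
      = ∑ a ∈ Finset.range (⌊y⌋₊ + 1), (a:ℝ) := by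
    rw [← Finset.sum_filter]
    rw [Finset.sum_range_succ', Nat.cast_zero, add_zero]
    rw [Finset.range_eq_Ico, Finset.sum_Ico_add' (fun b : ℕ => (b:ℝ)) 0 ⌊y⌋₊ 1]
    apply Finset.sum_congr _ (fun _ _ => rfl)
    ext a
    simp only [Finset.mem_filter, Finset.mem_Ico, zero_add]
    have key : 1 ≤ a → (u ≤ X / (a:ℝ)^2 ↔ (a:ℝ) ≤ y) := by
      intro ha
      have ha0 : (0:ℝ) < a := by exact_mod_cast ha
      rw [hy, Real.le_sqrt ha0.le (by positivity), le_div_iff₀ (by positivity), le_div_iff₀ hu0, mul_comm]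
    constructor
    · rintro ⟨⟨h1, h2⟩, h3⟩
      exact ⟨h1, Nat.lt_succ_of_le (Nat.le_floor ((key h1).1 h3))⟩
    · rintro ⟨h1, h2⟩
      have : (a:ℝ) ≤ y := (Nat.le_floor_iff hy0).1 (by omega)
      exact ⟨⟨h1, Nat.lt_ceil.2 (by linarith)⟩, (key h1).2 this⟩
  have gs : ∀ N : ℕ, ∑ a ∈ Finset.range (N + 1), (a:ℝ) = N * (N+1) / 2 := by
    intro N
    induction N with
    | zero => simp
    | succ n ih => rw [Finset.sum_range_succ, ih]; push_cast; ring
  rw [hs, gs]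
  have f1 : (⌊y⌋₊ : ℝ) ≤ y := Nat.floor_le hy0
  have f2 : y < (⌊y⌋₊ : ℝ) + 1 := Nat.lt_floor_add_one y
  have f0 : (0:ℝ) ≤ ⌊y⌋₊ := by positivity
  have e : X / (2 * u) = y^2/2 := by rw [hy2]; field_simp
  rw [e, abs_le]
  constructor <;> nlinarith

lemma F_bound (m : ℕ) (hm : 2 ≤ m) (X : ℝ) (hX : 1 ≤ X) :
    |∑ a ∈ Finset.Ico 1 ⌈√X⌉₊, (a:ℝ) * (∫ u in (1:ℝ)..(X / (a:ℝ)^2), hh m u) - X / m|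
      ≤ 3 * √X := by
  have hX0 : 0 < X := by linarith
  have hm' : (2:ℝ) ≤ m := by exact_mod_cast hm
  have hfacts : ∀ a ∈ Finset.Ico 1 ⌈√X⌉₊, (0:ℝ) < a ∧ 1 ≤ X / (a:ℝ)^2 ∧ X / (a:ℝ)^2 ≤ X := by
    intro a ha
    rw [Finset.mem_Ico] at ha
    have h1 : (1:ℝ) ≤ a := by exact_mod_cast ha.1
    have h2 : (a:ℝ) < √X := Nat.lt_ceil.1 ha.2
    have h3 : (a:ℝ)^2 < X := (Real.lt_sqrt (by positivity)).1 h2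
    refine ⟨by linarith, ?_, ?_⟩
    · rw [le_div_iff₀ (by positivity)]; linarith
    · exact div_le_self hX0.le (one_le_pow₀ h1)
  have hhi : IntegrableOn (hh m) (Set.Ioc 1 X) :=
    (intervalIntegrable_iff_integrableOn_Ioc_of_le hX).1 (hh_ii m one_pos hX0)
  have gi : ∀ c : ℝ, IntegrableOn (Set.indicator (Set.Iic c) (hh m)) (Set.Ioc 1 X) := fun c =>
    hhi.indicator measurableSet_Iic
  have hsum : ∑ a ∈ Finset.Ico 1 ⌈√X⌉₊, (a:ℝ) * (∫ u in (1:ℝ)..(X / (a:ℝ)^2), hh m u)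
      = ∫ u in (1:ℝ)..X, hh m u *
        ∑ a ∈ Finset.Ico 1 ⌈√X⌉₊, (if u ≤ X / (a:ℝ)^2 then (a:ℝ) else 0) := by
    have : ∀ u : ℝ, hh m u *
        ∑ a ∈ Finset.Ico 1 ⌈√X⌉₊, (if u ≤ X / (a:ℝ)^2 then (a:ℝ) else 0)
        = ∑ a ∈ Finset.Ico 1 ⌈√X⌉₊, (a:ℝ) * Set.indicator (Set.Iic (X / (a:ℝ)^2)) (hh m) u := by
      intro u
      rw [Finset.mul_sum]
      apply Finset.sum_congr rfl
      intro a _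
      rw [Set.indicator_apply]
      simp only [Set.mem_Iic]
      split_ifs <;> ring
    simp_rw [this]
    rw [intervalIntegral.integral_of_le hX, integral_finsetSum _ (fun a _ => (gi _).const_mul _)]
    apply Finset.sum_congr rfl
    intro a ha
    obtain ⟨h1, h2, h3⟩ := hfacts a ha
    rw [MeasureTheory.integral_const_mul, setIntegral_indicator measurableSet_Iic, Set.Ioc_inter_Iic,
      min_eq_right h3, intervalIntegral.integral_of_le h2]
  have hAi : IntervalIntegrable (fun u => hh m u *
        ∑ a ∈ Finset.Ico 1 ⌈√X⌉₊, (if u ≤ X / (a:ℝ)^2 then (a:ℝ) else 0)) volume 1 X := by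
    rw [intervalIntegrable_iff_integrableOn_Ioc_of_le hX]
    have : (fun u : ℝ => hh m u *
        ∑ a ∈ Finset.Ico 1 ⌈√X⌉₊, (if u ≤ X / (a:ℝ)^2 then (a:ℝ) else 0))
        = fun u => ∑ a ∈ Finset.Ico 1 ⌈√X⌉₊, (a:ℝ) * Set.indicator (Set.Iic (X / (a:ℝ)^2)) (hh m) u := by
      funext u
      rw [Finset.mul_sum]
      apply Finset.sum_congr rfl
      intro a _
      rw [Set.indicator_apply]
      simp only [Set.mem_Iic]
      split_ifs <;> ring
    rw [this]
    exact integrable_finsetSum _ (fun a _ => (gi _).const_mul _)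
  have h0 : (0:ℝ) ∉ Set.uIcc 1 X := by
    rw [Set.uIcc_of_le hX]; intro h; linarith [h.1]
  have rpi : ∀ r : ℝ, IntervalIntegrable (fun u : ℝ => u ^ r) volume 1 X := fun r =>
    intervalIntegrable_rpow (Or.inr h0)
  have hmain : ∫ u in (1:ℝ)..X, (X/2) * u ^ (-(m:ℝ)/2 - 1) = X / m * (1 - X ^ (-(m:ℝ)/2)) := by
    rw [intervalIntegral.integral_const_mul, integral_rpow (Or.inr ⟨by linarith, h0⟩)]
    have : (m:ℝ) ≠ 0 := by positivity
    rw [sub_add_cancel, Real.one_rpow]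
    field_simp
    ring
  have herr : ∫ u in (1:ℝ)..X, √X * u ^ (-(3/2):ℝ) ≤ 2 * √X := by
    rw [intervalIntegral.integral_const_mul, integral_rpow (Or.inr ⟨by norm_num, h0⟩)]
    have : 0 ≤ X ^ (-(3/2) + 1 : ℝ) := by positivity
    have h2 : 0 ≤ √X := Real.sqrt_nonneg _
    rw [Real.one_rpow, mul_comm]
    apply mul_le_mul_of_nonneg_right _ h2
    rw [div_le_iff_of_neg (by norm_num)]
    linarith
  have hdiff : ‖∫ u in (1:ℝ)..X, (hh m u *
        ∑ a ∈ Finset.Ico 1 ⌈√X⌉₊, (if u ≤ X / (a:ℝ)^2 then (a:ℝ) else 0)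
        - (X/2) * u ^ (-(m:ℝ)/2 - 1))‖ ≤ ∫ u in (1:ℝ)..X, √X * u ^ (-(3/2):ℝ) := by
    apply intervalIntegral.norm_integral_le_of_norm_le hX _ ((rpi _).const_mul _)
    refine Filter.Eventually.of_forall ?_
    intro u hu
    have hu0 : 0 < u := by linarith [hu.1]
    have e : (X/2) * u ^ (-(m:ℝ)/2 - 1) = hh m u * (X / (2 * u)) := by
      rw [Real.rpow_sub_one hu0.ne']; unfold hh; field_simp
    rw [e, ← mul_sub, Real.norm_eq_abs, abs_mul, abs_of_nonneg (hh_nonneg m hu0.le)]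
    have hb : hh m u ≤ u ^ (-1:ℝ) := by
      unfold hh
      apply Real.rpow_le_rpow_of_exponent_le hu.1.le
      linarith
    calc _ ≤ u ^ (-1:ℝ) * √(X/u) :=
          mul_le_mul hb (A_bound X u hu.1 hu.2) (abs_nonneg _) (by positivity)
      _ = √X * u ^ (-(3/2):ℝ) := by
          rw [Real.sqrt_div hX0.le, Real.sqrt_eq_rpow u, div_eq_mul_inv, ← Real.rpow_neg hu0.le,
            mul_left_comm, ← Real.rpow_add hu0]
          norm_num
  rw [intervalIntegral.integral_sub hAi ((rpi _).const_mul _), hmain, ← hsum, Real.norm_eq_abs] at hdiff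
  have htail : X / m * X ^ (-(m:ℝ)/2) ≤ √X := by
    have h1 : X ^ (-(m:ℝ)/2) ≤ X ^ (-1:ℝ) :=
      Real.rpow_le_rpow_of_exponent_le hX (by linarith)
    rw [Real.rpow_neg_one] at h1
    have h2 : 1 ≤ √X := Real.one_le_sqrt.2 hX
    calc X / m * X ^ (-(m:ℝ)/2) ≤ X / m * X⁻¹ := by gcongr
      _ = 1 / m := by field_simp
      _ ≤ 1 := by rw [div_le_one (by positivity)]; linarith
      _ ≤ _ := h2
  have htail0 : 0 ≤ X / m * X ^ (-(m:ℝ)/2) := by positivity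
  have := hdiff.trans herr
  rw [abs_le] at this ⊢
  constructor <;> linarith [this.1, this.2]

noncomputable def WW (m a b : ℕ) : ℝ :=
  (min ((a : ℝ) / √((a*b:ℕ):ℝ)) (√((a*b:ℕ):ℝ) / a)) ^ m

lemma WW_symm (m a b : ℕ) (ha : 1 ≤ a) (hb : 1 ≤ b) : WW m a b = WW m b a := by
  have ha0 : (0:ℝ) < a := by exact_mod_cast ha
  have hb0 : (0:ℝ) < b := by exact_mod_cast hb
  unfold WW
  rw [mul_comm b a]
  have hs : √((a*b:ℕ):ℝ) * √((a*b:ℕ):ℝ) = a * b := by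
    rw [Real.mul_self_sqrt (by positivity)]; push_cast; ring
  have hs0 : 0 < √((a*b:ℕ):ℝ) := Real.sqrt_pos.2 (by push_cast; positivity)
  rw [min_comm]
  congr 2
  · rw [div_eq_div_iff ha0.ne' hs0.ne']; linarith
  · rw [div_eq_div_iff hs0.ne' hb0.ne']; linarith

lemma WW_eq (m a b : ℕ) (ha : 1 ≤ a) (hab : a ≤ b) : WW m a b = hh m (b / a) := by
  have ha0 : (0:ℝ) < a := by exact_mod_cast ha
  have hab' : (a:ℝ) ≤ b := by exact_mod_cast hab
  have hb0 : (0:ℝ) < b := by linarith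
  have hs0 : 0 < √((a*b:ℕ):ℝ) := Real.sqrt_pos.2 (by push_cast; positivity)
  have hle : (a:ℝ) ≤ √((a*b:ℕ):ℝ) := by
    apply Real.le_sqrt_of_sq_le; push_cast; nlinarith
  unfold WW hh
  rw [min_eq_left]
  · have e : (a:ℝ) / √((a*b:ℕ):ℝ) = (b / a : ℝ) ^ (-(1/2) : ℝ) := by
      rw [Real.rpow_neg (by positivity), ← Real.sqrt_eq_rpow, Real.sqrt_div hb0.le]
      push_cast
      rw [Real.sqrt_mul ha0.le, inv_div]
      have := Real.sqrt_pos.2 ha0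
      have := Real.sqrt_pos.2 hb0
      rw [div_eq_div_iff (by positivity) (by positivity)]
      nlinarith [Real.mul_self_sqrt ha0.le]
    rw [e, ← Real.rpow_natCast, ← Real.rpow_mul (by positivity)]
    congr 1; ring
  · exact ((div_le_one hs0).2 hle).trans ((one_le_div ha0).2 hle)

lemma sum_rearr (M : ℕ) (w : ℕ → ℕ → ℝ) :
    ∑ n ∈ Finset.Ico 1 M, ∑ p ∈ n.divisorsAntidiagonal, w p.1 p.2
      = ∑ a ∈ Finset.Ico 1 M, ∑ b ∈ Finset.Ico 1 M, if a * b < M then w a b else 0 := by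
  rw [Finset.sum_sigma', ← Finset.sum_product', ← Finset.sum_filter]
  refine Finset.sum_bij' (fun x _ => x.2) (fun p _ => ⟨p.1 * p.2, p⟩) ?_ ?_ ?_ ?_ ?_
  · rintro ⟨n, a, b⟩ h
    simp only [Finset.mem_sigma, Finset.mem_Ico, Nat.mem_divisorsAntidiagonal, Finset.mem_filter,
      Finset.mem_product] at h ⊢
    obtain ⟨⟨h1, h2⟩, rfl, h3⟩ := h
    have ha : 0 < a := Nat.pos_of_ne_zero (by rintro rfl; simp at h3)
    have hb : 0 < b := Nat.pos_of_ne_zero (by rintro rfl; simp at h3)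
    refine ⟨⟨⟨ha, ?_⟩, hb, ?_⟩, h2⟩ <;> nlinarith
  · rintro ⟨a, b⟩ h
    simp only [Finset.mem_sigma, Finset.mem_Ico, Nat.mem_divisorsAntidiagonal, Finset.mem_filter,
      Finset.mem_product] at h ⊢
    have : 0 < a * b := Nat.mul_pos h.1.1.1 h.1.2.1
    exact ⟨⟨this, h.2⟩, by simp, this.ne'⟩
  · rintro ⟨n, a, b⟩ h
    simp only [Finset.mem_sigma, Nat.mem_divisorsAntidiagonal] at h
    obtain ⟨_, rfl, _⟩ := h
    rfl
  · rintro ⟨a, b⟩ h; rfl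
  · rintro ⟨n, a, b⟩ h; rfl

lemma sum_split (M : ℕ) (w : ℕ → ℕ → ℝ) (hw : ∀ a b, 1 ≤ a → 1 ≤ b → w a b = w b a) :
    ∑ a ∈ Finset.Ico 1 M, ∑ b ∈ Finset.Ico 1 M, (if a * b < M then w a b else 0)
      = 2 * (∑ a ∈ Finset.Ico 1 M, ∑ b ∈ Finset.Ico 1 M, if a < b ∧ a * b < M then w a b else 0)
        + ∑ a ∈ Finset.Ico 1 M, if a * a < M then w a a else 0 := by
  have h1 : ∀ a ∈ Finset.Ico 1 M, ∀ b ∈ Finset.Ico 1 M, (if a * b < M then w a b else 0)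
      = (if a < b ∧ a * b < M then w a b else 0) + (if b < a ∧ b * a < M then w b a else 0)
        + (if a = b then (if a * a < M then w a a else 0) else 0) := by
    intro a ha b hb
    rw [Finset.mem_Ico] at ha hb
    rw [hw b a hb.1 ha.1, mul_comm b a]
    rcases lt_trichotomy a b with h | h | h
    · simp [h, h.not_gt, h.ne]
    · subst h; simp
    · simp [h, h.not_gt, h.ne']
  rw [Finset.sum_congr rfl (fun a ha => Finset.sum_congr rfl (h1 a ha))]
  simp only [Finset.sum_add_distrib]
  rw [Finset.sum_comm (f := fun a b => if b < a ∧ b * a < M then w b a else 0), two_mul]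
  congr 1
  apply Finset.sum_congr rfl
  intro a ha
  rw [Finset.sum_ite_eq, if_pos ha]

lemma card_bound (X : ℝ) (hX : 1 ≤ X) : (((Finset.Ico 1 ⌈√X⌉₊).card : ℕ) : ℝ) ≤ √X := by
  have h := Nat.ceil_lt_add_one (Real.sqrt_nonneg X)
  have h2 : 1 ≤ ⌈√X⌉₊ := Nat.one_le_ceil_iff.2 (by positivity)
  rw [Nat.card_Ico, Nat.cast_sub h2]
  push_cast
  linarith

lemma sqrt_mem (X : ℝ) (a : ℕ) : a < ⌈√X⌉₊ ↔ a * a < ⌈X⌉₊ := by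
  rw [Nat.lt_ceil, Nat.lt_ceil, Real.lt_sqrt (by positivity), sq]
  push_cast
  rfl

lemma T_eq (m : ℕ) (X : ℝ) :
    (∑ a ∈ Finset.Ico 1 ⌈X⌉₊, ∑ b ∈ Finset.Ico 1 ⌈X⌉₊,
        if a < b ∧ a * b < ⌈X⌉₊ then WW m a b else 0)
      = ∑ a ∈ Finset.Ico 1 ⌈√X⌉₊, ∑ b ∈ Finset.Ico (a+1) ⌈X / a⌉₊, hh m (b / a) := by
  have hsub : Finset.Ico 1 ⌈√X⌉₊ ⊆ Finset.Ico 1 ⌈X⌉₊ := by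
    intro a ha
    rw [Finset.mem_Ico, sqrt_mem] at ha
    rw [Finset.mem_Ico]
    exact ⟨ha.1, by nlinarith⟩
  rw [← Finset.sum_subset hsub]
  · apply Finset.sum_congr rfl
    intro a ha
    rw [Finset.mem_Ico] at ha
    have ha0 : (0:ℝ) < a := by exact_mod_cast ha.1
    rw [← Finset.sum_filter]
    apply Finset.sum_congr
    · ext b
      have : b < ⌈X / a⌉₊ ↔ a * b < ⌈X⌉₊ := by
        rw [Nat.lt_ceil, Nat.lt_ceil, lt_div_iff₀ ha0, mul_comm]; push_cast; rfl
      simp only [Finset.mem_filter, Finset.mem_Ico, this]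
      constructor
      · rintro ⟨_, h1, h2⟩; exact ⟨h1, h2⟩
      · rintro ⟨h1, h2⟩; exact ⟨⟨by omega, by nlinarith⟩, h1, h2⟩
    · intro b hb
      rw [Finset.mem_Ico] at hb
      exact WW_eq m a b ha.1 (by omega)
  · intro a ha hna
    rw [Finset.mem_Ico] at ha hna
    apply Finset.sum_eq_zero
    intro b _
    rw [if_neg]
    rintro ⟨h1, h2⟩
    apply hna
    refine ⟨ha.1, (sqrt_mem X a).2 (by nlinarith)⟩

/-- The contribution of the hyperbolic and unipotent conjugacy classes to the
averaged Selberg trace formula: for an integer `k ≥ 3` there is a constant `C`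
(depending only on `k`) such that for all real `X ≥ 1`,
`|−(1/2)·∑_{1 ≤ n < X} ∑_{d ∣ n} min(d/√n, √n/d)^{k−1} − X/(1−k)| ≤ C·√X`. -/
theorem hyperbolic_unipotent_contribution (k : ℕ) (hk : 3 ≤ k) :
    ∃ C : ℝ, ∀ X : ℝ, 1 ≤ X →
      |(-(1/2) * ∑ n ∈ Finset.Ico 1 ⌈X⌉₊, ∑ d ∈ n.divisors,
            (min ((d : ℝ) / Real.sqrt n) (Real.sqrt n / d)) ^ (k - 1))
          - X / (1 - (k : ℝ))| ≤ C * Real.sqrt X := by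
  obtain ⟨m, rfl⟩ : ∃ m, k = m + 1 := ⟨k - 1, by omega⟩
  have hm : 2 ≤ m := by omega
  refine ⟨5, fun X hX => ?_⟩
  have hS : ∑ n ∈ Finset.Ico 1 ⌈X⌉₊, ∑ d ∈ n.divisors,
      (min ((d : ℝ) / Real.sqrt n) (Real.sqrt n / d)) ^ (m + 1 - 1)
      = ∑ n ∈ Finset.Ico 1 ⌈X⌉₊, ∑ p ∈ n.divisorsAntidiagonal, WW m p.1 p.2 := by
    apply Finset.sum_congr rfl
    intro n _
    rw [← Nat.sum_divisorsAntidiagonal (n := n)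
      (fun (d _ : ℕ) => (min ((d : ℝ) / Real.sqrt n) (Real.sqrt n / d)) ^ (m + 1 - 1))]
    apply Finset.sum_congr rfl
    rintro ⟨a, b⟩ h
    rw [Nat.mem_divisorsAntidiagonal] at h
    obtain ⟨rfl, _⟩ := h
    rfl
  rw [hS, sum_rearr, sum_split _ _ (WW_symm m), T_eq]
  have hD : (∑ a ∈ Finset.Ico 1 ⌈X⌉₊, if a * a < ⌈X⌉₊ then WW m a a else 0)
      = ((Finset.Ico 1 ⌈√X⌉₊).card : ℝ) := by
    rw [← Finset.sum_filter, Finset.card_eq_sum_ones, Nat.cast_sum]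
    apply Finset.sum_congr
    · ext a
      simp only [Finset.mem_filter, Finset.mem_Ico, sqrt_mem]
      constructor
      · rintro ⟨⟨h1, _⟩, h2⟩; exact ⟨h1, h2⟩
      · rintro ⟨h1, h2⟩; exact ⟨⟨h1, by nlinarith⟩, h2⟩
    · intro a ha
      rw [Finset.mem_Ico] at ha
      have ha0 : (a:ℝ) ≠ 0 := by
        have : a ≠ 0 := by omega
        exact_mod_cast this
      rw [WW_eq m a a ha.1 le_rfl, div_self ha0, hh_one, Nat.cast_one]
  rw [hD]
  have hc := card_bound X hX
  have hc0 : (0:ℝ) ≤ ((Finset.Ico 1 ⌈√X⌉₊).card : ℝ) := by positivity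
  have hF := F_bound m hm X hX
  have hT : |∑ a ∈ Finset.Ico 1 ⌈√X⌉₊, ∑ b ∈ Finset.Ico (a+1) ⌈X / a⌉₊, hh m (b / a)
      - ∑ a ∈ Finset.Ico 1 ⌈√X⌉₊, (a:ℝ) * (∫ u in (1:ℝ)..(X / (a:ℝ)^2), hh m u)|
      ≤ ((Finset.Ico 1 ⌈√X⌉₊).card : ℝ) := by
    rw [← Finset.sum_sub_distrib]
    refine (Finset.abs_sum_le_sum_abs _ _).trans ?_
    rw [Finset.card_eq_sum_ones, Nat.cast_sum]
    apply Finset.sum_le_sum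
    intro a ha
    rw [Finset.mem_Ico] at ha
    rw [Nat.cast_one]
    exact inner_bound m a ha.1 X ((Real.lt_sqrt (by positivity)).1 (Nat.lt_ceil.1 ha.2))
  have e : X / (1 - ((m + 1 : ℕ) : ℝ)) = - (X / m) := by
    push_cast
    rw [show (1 - ((m:ℝ) + 1)) = -(m:ℝ) by ring, div_neg]
  rw [e]
  rw [abs_le] at hF hT ⊢
  constructor <;> linarith [hF.1, hF.2, hT.1, hT.2]
end

section
/- Let k ≥ 3 be an integer. There is a constant C depending only on k such that for all real X ≥ 1: | ∑_{√X < b < X} ∑_{1 ≤ a < X/b} (a/b)^{(k−1)/2} − 2X/((k+1)(k−1)) | ≤ C·√X, where a and b run over positive integers. -/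
lemma tang {p x y : ℝ} (hp : 1 ≤ p) (hx : 0 < x) (hy : 0 ≤ y) :
    x ^ p + p * x ^ (p - 1) * (y - x) ≤ y ^ p := by
  have h := one_add_mul_self_le_rpow_one_add (s := y / x - 1) (by
    have : 0 ≤ y / x := by positivity
    linarith) hp
  have e : 1 + (y / x - 1) = y / x := by ring
  rw [e, Real.div_rpow hy hx.le, le_div_iff₀ (by positivity)] at h
  have e2 : x ^ p = x ^ (p - 1) * x := by
    rw [Real.rpow_sub_one hx.ne']; field_simp
  rw [e2] at h ⊢
  refine le_trans (le_of_eq ?_) h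
  field_simp

lemma tang_neg {r x y : ℝ} (hr : 0 ≤ r) (hx : 0 < x) (hy : 0 < y) :
    x ^ (-r) - r * x ^ (-(r + 1)) * (y - x) ≤ y ^ (-r) := by
  have hz : 0 < y / x := by positivity
  have h : 1 - r * (y / x - 1) ≤ (y / x) ^ (-r) := by
    rw [Real.rpow_def_of_pos hz]
    have h1 := Real.add_one_le_exp (Real.log (y / x) * -r)
    have h2 := Real.log_le_sub_one_of_pos hz
    nlinarith
  rw [Real.div_rpow hy.le hx.le, le_div_iff₀ (by positivity)] at h
  have e2 : x ^ (-r) = x ^ (-(r + 1)) * x := by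
    rw [show -r = -(r + 1) + 1 by ring, Real.rpow_add_one hx.ne']
  rw [e2] at h ⊢
  refine le_trans (le_of_eq ?_) h
  field_simp

lemma innerN {s : ℝ} (hs : 1 ≤ s) (n : ℕ) :
    (n : ℝ) ^ (s + 1) / (s + 1) ≤ ∑ a ∈ Finset.Ico 1 (n + 1), (a : ℝ) ^ s ∧
    ∑ a ∈ Finset.Ico 1 (n + 1), (a : ℝ) ^ s ≤ (n : ℝ) ^ (s + 1) / (s + 1) + (n : ℝ) ^ s := by
  induction n with
  | zero => simp [Real.zero_rpow (by linarith : s + 1 ≠ 0), Real.zero_rpow (by linarith : s ≠ 0)]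
  | succ n ih =>
    rw [Finset.sum_Ico_succ_top (by omega)]
    have hs1 : 0 < s + 1 := by linarith
    have h1 := tang (p := s + 1) (x := (n : ℝ) + 1) (y := n) (by linarith) (by positivity) (by positivity)
    have h2 : (n : ℝ) ^ (s + 1) + (s + 1) * (n : ℝ) ^ s ≤ ((n : ℝ) + 1) ^ (s + 1) := by
      rcases Nat.eq_zero_or_pos n with h0 | h0
      · subst h0
        simp [Real.zero_rpow (by linarith : s + 1 ≠ 0), Real.zero_rpow (by linarith : s ≠ 0)]
      · have := tang (p := s + 1) (x := (n : ℝ)) (y := n + 1) (by linarith) (by positivity) (by positivity)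
        simpa using this
    simp only [add_sub_cancel_right] at h1
    push_cast
    have e1 : ((n : ℝ) + 1) ^ (s + 1) / (s + 1) ≤ (n : ℝ) ^ (s + 1) / (s + 1) + ((n : ℝ) + 1) ^ s := by
      rw [div_add' _ _ _ hs1.ne', div_le_div_iff_of_pos_right hs1]; linarith
    have e2 : (n : ℝ) ^ (s + 1) / (s + 1) + (n : ℝ) ^ s ≤ ((n : ℝ) + 1) ^ (s + 1) / (s + 1) := by
      rw [div_add' _ _ _ hs1.ne', div_le_div_iff_of_pos_right hs1]; linarith
    constructor <;> linarith [ih.1, ih.2]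

lemma innerY {s Y : ℝ} (hs : 1 ≤ s) (hY : 1 ≤ Y) :
    |∑ a ∈ Finset.Ico 1 ⌈Y⌉₊, (a : ℝ) ^ s - Y ^ (s + 1) / (s + 1)| ≤ Y ^ s := by
  obtain ⟨n, hn⟩ : ∃ n, ⌈Y⌉₊ = n + 1 := Nat.exists_eq_succ_of_ne_zero (by
    have := Nat.ceil_pos.2 (by linarith : 0 < Y); omega)
  have h1 : (n : ℝ) ≤ Y := (Nat.lt_ceil.1 (by omega)).le
  have h2 : Y ≤ n + 1 := by
    have := Nat.le_ceil Y; rw [hn] at this; exact_mod_cast this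
  rw [hn]
  obtain ⟨l, u⟩ := innerN hs n
  have hs1 : 0 < s + 1 := by linarith
  have a1 : (n : ℝ) ^ (s + 1) / (s + 1) ≤ Y ^ (s + 1) / (s + 1) := by gcongr
  have a2 : (n : ℝ) ^ s ≤ Y ^ s := by gcongr
  have a3 : (Y - 1) ^ (s + 1) / (s + 1) ≤ (n : ℝ) ^ (s + 1) / (s + 1) := by
    gcongr <;> linarith
  have h3 := tang (p := s + 1) (x := Y) (y := Y - 1) (by linarith) (by linarith) (by linarith)
  simp only [add_sub_cancel_right] at h3
  have a4 : Y ^ (s + 1) / (s + 1) ≤ (Y - 1) ^ (s + 1) / (s + 1) + Y ^ s := by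
    rw [div_add' _ _ _ hs1.ne', div_le_div_iff_of_pos_right hs1]; linarith
  rw [abs_le]; constructor <;> linarith

lemma outer_lo {r : ℝ} (hr : 0 < r) {M N : ℕ} (hM : 1 ≤ M) (hN : 1 ≤ N) :
    (M : ℝ) ^ (-r) / r - (N : ℝ) ^ (-r) / r ≤ ∑ b ∈ Finset.Ico M N, (b : ℝ) ^ (-(r + 1)) := by
  rcases le_total N M with h | h
  · rw [Finset.Ico_eq_empty_of_le h, Finset.sum_empty, sub_nonpos]
    have : (M : ℝ) ^ (-r) ≤ (N : ℝ) ^ (-r) :=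
      Real.rpow_le_rpow_of_nonpos (by exact_mod_cast hN) (by exact_mod_cast h) (by linarith)
    gcongr
  · induction N, h using Nat.le_induction with
    | base => simp
    | succ n hn ih =>
      rw [Finset.sum_Ico_succ_top hn]
      have ih := ih (by omega)
      have hn0 : (0 : ℝ) < n := by exact_mod_cast (by omega : 0 < n)
      have := tang_neg (r := r) (x := n) (y := n + 1) hr.le hn0 (by positivity)
      have e : (n : ℝ) ^ (-r) / r ≤ ((n : ℝ) + 1) ^ (-r) / r + (n : ℝ) ^ (-(r + 1)) := by
        rw [div_add' _ _ _ hr.ne', div_le_div_iff_of_pos_right hr]; linarith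
      push_cast
      linarith

lemma outer_hi {r : ℝ} (hr : 0 < r) {M N : ℕ} (hM : 1 ≤ M) :
    ∑ b ∈ Finset.Ico M N, (b : ℝ) ^ (-(r + 1)) ≤ (M : ℝ) ^ (-(r + 1)) + (M : ℝ) ^ (-r) / r := by
  have key : ∀ n, M ≤ n → ∑ b ∈ Finset.Ico M (n + 1), (b : ℝ) ^ (-(r + 1)) ≤
      (M : ℝ) ^ (-(r + 1)) + (M : ℝ) ^ (-r) / r - (n : ℝ) ^ (-r) / r := by
    intro n hn
    induction n, hn using Nat.le_induction with
    | base => simp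
    | succ n hn ih =>
      rw [Finset.sum_Ico_succ_top (by omega)]
      have hn0 : (0 : ℝ) < n := by exact_mod_cast (by omega : 0 < n)
      have := tang_neg (r := r) (x := n + 1) (y := n) hr.le (by positivity) hn0
      have e : ((n : ℝ) + 1) ^ (-r) / r + ((n : ℝ) + 1) ^ (-(r + 1)) ≤ (n : ℝ) ^ (-r) / r := by
        rw [div_add' _ _ _ hr.ne', div_le_div_iff_of_pos_right hr]; linarith
      push_cast
      linarith
  rcases lt_or_ge M N with h | h
  · obtain ⟨n, rfl⟩ : ∃ n, N = n + 1 := ⟨N - 1, by omega⟩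
    have := key n (by omega)
    have : 0 ≤ (n : ℝ) ^ (-r) / r := by positivity
    linarith
  · rw [Finset.Ico_eq_empty_of_le h, Finset.sum_empty]
    positivity

lemma outerX {r X : ℝ} (hr : 0 < r) (hX : 1 ≤ X) :
    ∑ b ∈ Finset.Ico (⌊√X⌋₊ + 1) ⌈X⌉₊, (b : ℝ) ^ (-(r + 1)) ≤
      (√X) ^ (-(r + 1)) + (√X) ^ (-r) / r ∧
    (√X) ^ (-r) / r - (√X) ^ (-(r + 1)) - X ^ (-r) / r ≤
    ∑ b ∈ Finset.Ico (⌊√X⌋₊ + 1) ⌈X⌉₊, (b : ℝ) ^ (-(r + 1)) := by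
  have hq : 0 < √X := by positivity
  have hN : 1 ≤ ⌈X⌉₊ := Nat.ceil_pos.2 (by linarith)
  have m1 : √X ≤ ((⌊√X⌋₊ + 1 : ℕ) : ℝ) := by push_cast; exact (Nat.lt_floor_add_one _).le
  have m2 : ((⌊√X⌋₊ + 1 : ℕ) : ℝ) ≤ √X + 1 := by
    push_cast; linarith [Nat.floor_le hq.le]
  have lo := outer_lo hr (M := ⌊√X⌋₊ + 1) (by omega) hN
  have hi := outer_hi hr (M := ⌊√X⌋₊ + 1) (N := ⌈X⌉₊) (by omega)
  have m0 := hq.trans_le m1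
  set m : ℝ := ((⌊√X⌋₊ + 1 : ℕ) : ℝ)
  have b1 : m ^ (-(r + 1)) ≤ (√X) ^ (-(r + 1)) :=
    Real.rpow_le_rpow_of_nonpos hq m1 (by linarith)
  have b2 : m ^ (-r) / r ≤ (√X) ^ (-r) / r := by
    have := Real.rpow_le_rpow_of_nonpos hq m1 (by linarith : -r ≤ 0)
    gcongr
  have b3 : (⌈X⌉₊ : ℝ) ^ (-r) / r ≤ X ^ (-r) / r := by
    have := Real.rpow_le_rpow_of_nonpos (by linarith) (Nat.le_ceil X) (by linarith : -r ≤ 0)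
    gcongr
  have b4 : (√X) ^ (-r) / r ≤ m ^ (-r) / r + (√X) ^ (-(r + 1)) := by
    have := tang_neg (r := r) hr.le hq m0
    have h0 : r * (√X) ^ (-(r + 1)) * (m - √X) ≤ r * (√X) ^ (-(r + 1)) * 1 := by
      gcongr; linarith
    rw [div_add' _ _ _ hr.ne', div_le_div_iff_of_pos_right hr]; linarith
  constructor <;> linarith

lemma mainS {s X : ℝ} (hs : 1 ≤ s) (hX : 1 ≤ X) :
    |(∑ b ∈ (Finset.Ico 1 ⌈X⌉₊).filter (fun b : ℕ => Real.sqrt X < (b : ℝ)),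
            ∑ a ∈ Finset.Ico 1 ⌈X / (b : ℝ)⌉₊, ((a : ℝ) / (b : ℝ)) ^ s)
          - X / (2 * s * (s + 1))| ≤ 4 * Real.sqrt X := by
  have hX0 : 0 < X := by linarith
  have hq : 0 < √X := by positivity
  have hq1 : 1 ≤ √X := Real.one_le_sqrt.2 hX
  have hset : (Finset.Ico 1 ⌈X⌉₊).filter (fun b : ℕ => Real.sqrt X < (b : ℝ)) =
      Finset.Ico (⌊√X⌋₊ + 1) ⌈X⌉₊ := by
    ext b
    simp only [Finset.mem_filter, Finset.mem_Ico, Nat.succ_le_iff, Nat.floor_lt hq.le]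
    constructor
    · rintro ⟨⟨_, h⟩, h'⟩; exact ⟨h', h⟩
    · rintro ⟨h', h⟩
      exact ⟨⟨by exact_mod_cast hq.trans h', h⟩, h'⟩
  rw [hset]
  set I := Finset.Ico (⌊√X⌋₊ + 1) ⌈X⌉₊ with hI
  have step : |(∑ b ∈ I, ∑ a ∈ Finset.Ico 1 ⌈X / (b : ℝ)⌉₊, ((a : ℝ) / (b : ℝ)) ^ s)
      - X ^ (s + 1) / (s + 1) * ∑ b ∈ I, (b : ℝ) ^ (-(2 * s + 1))| ≤
      X ^ s * ∑ b ∈ I, (b : ℝ) ^ (-(2 * s - 1 + 1)) := by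
    rw [Finset.mul_sum, Finset.mul_sum, ← Finset.sum_sub_distrib]
    refine (Finset.abs_sum_le_sum_abs _ _).trans (Finset.sum_le_sum fun b hb => ?_)
    rw [hI, Finset.mem_Ico] at hb
    have hb0 : (0 : ℝ) < b := by exact_mod_cast (by omega : 0 < b)
    have hbX : (b : ℝ) < X := Nat.lt_ceil.1 hb.2
    have h := innerY (Y := X / b) hs (by rw [le_div_iff₀ hb0]; linarith)
    have e : ∑ a ∈ Finset.Ico 1 ⌈X / (b : ℝ)⌉₊, ((a : ℝ) / (b : ℝ)) ^ s =
        (b : ℝ) ^ (-s) * ∑ a ∈ Finset.Ico 1 ⌈X / (b : ℝ)⌉₊, (a : ℝ) ^ s := by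
      rw [Finset.mul_sum]
      refine Finset.sum_congr rfl fun a _ => ?_
      rw [Real.div_rpow (by positivity) hb0.le, Real.rpow_neg hb0.le]
      ring
    have e1 : X ^ (s + 1) / (s + 1) * (b : ℝ) ^ (-(2 * s + 1)) =
        (b : ℝ) ^ (-s) * ((X / b) ^ (s + 1) / (s + 1)) := by
      rw [Real.div_rpow hX0.le hb0.le, show -(2 * s + 1) = -s + -(s + 1) by ring,
        Real.rpow_add hb0, Real.rpow_neg hb0.le (s + 1)]
      ring
    have e2 : X ^ s * (b : ℝ) ^ (-(2 * s - 1 + 1)) = (b : ℝ) ^ (-s) * (X / b) ^ s := by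
      rw [Real.div_rpow hX0.le hb0.le, show -(2 * s - 1 + 1) = -s + -s by ring,
        Real.rpow_add hb0, Real.rpow_neg hb0.le s]
      ring
    rw [e, e1, e2, ← mul_sub, abs_mul, abs_of_pos (by positivity : 0 < (b : ℝ) ^ (-s))]
    gcongr
  obtain ⟨u1, l1⟩ := outerX (r := 2 * s) (by linarith) hX
  obtain ⟨u2, -⟩ := outerX (r := 2 * s - 1) (by linarith) hX
  rw [← hI] at u1 l1 u2
  have sq : ∀ t : ℝ, X ^ t = (√X) ^ (2 * t) := by
    intro t
    rw [Real.rpow_mul hq.le, Real.rpow_two, Real.sq_sqrt hX0.le]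
  have p1 : X ^ s * (√X) ^ (-(2 * s - 1 + 1)) = 1 := by
    rw [sq, ← Real.rpow_add hq]; ring_nf; simp
  have p2 : X ^ s * (√X) ^ (-(2 * s - 1)) = √X := by
    rw [sq, ← Real.rpow_add hq]; ring_nf; simp
  have p3 : X ^ (s + 1) * (√X) ^ (-(2 * s + 1)) = √X := by
    rw [sq, ← Real.rpow_add hq]; ring_nf; simp
  have p4 : X ^ (s + 1) * (√X) ^ (-(2 * s)) = X := by
    rw [sq, ← Real.rpow_add hq]; ring_nf; simp [Real.sq_sqrt hX0.le]
  have p5 : X ^ (s + 1) * X ^ (-(2 * s)) ≤ 1 := by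
    rw [← Real.rpow_add hX0]
    exact Real.rpow_le_one_of_one_le_of_nonpos hX (by linarith)
  have f2 : X ^ s * ∑ b ∈ I, (b : ℝ) ^ (-(2 * s - 1 + 1)) ≤ 2 * √X := by
    calc _ ≤ X ^ s * ((√X) ^ (-(2 * s - 1 + 1)) + (√X) ^ (-(2 * s - 1)) / (2 * s - 1)) := by gcongr
      _ = 1 + √X / (2 * s - 1) := by rw [mul_add, p1, ← mul_div_assoc, p2]
      _ ≤ _ := by
        have : √X / (2 * s - 1) ≤ √X := div_le_self hq.le (by linarith)
        linarith
  have c1 : √X / (s + 1) ≤ √X := div_le_self hq.le (by linarith)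
  have f3 : X ^ (s + 1) / (s + 1) * ∑ b ∈ I, (b : ℝ) ^ (-(2 * s + 1)) ≤
      X / (2 * s * (s + 1)) + √X := by
    calc _ ≤ X ^ (s + 1) / (s + 1) * ((√X) ^ (-(2 * s + 1)) + (√X) ^ (-(2 * s)) / (2 * s)) := by
          gcongr
      _ = (X ^ (s + 1) * (√X) ^ (-(2 * s + 1))) / (s + 1)
          + (X ^ (s + 1) * (√X) ^ (-(2 * s))) / (2 * s * (s + 1)) := by field_simp
      _ ≤ _ := by rw [p3, p4]; linarith
  have f4 : X / (2 * s * (s + 1)) - 2 * √X ≤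
      X ^ (s + 1) / (s + 1) * ∑ b ∈ I, (b : ℝ) ^ (-(2 * s + 1)) := by
    calc _ ≤ (X ^ (s + 1) * (√X) ^ (-(2 * s))) / (2 * s * (s + 1))
          - (X ^ (s + 1) * (√X) ^ (-(2 * s + 1))) / (s + 1)
          - (X ^ (s + 1) * X ^ (-(2 * s))) / (2 * s * (s + 1)) := by
          rw [p3, p4]
          have : X ^ (s + 1) * X ^ (-(2 * s)) / (2 * s * (s + 1)) ≤ 1 :=
            (div_le_self (by positivity) (by nlinarith)).trans p5
          linarith
      _ = X ^ (s + 1) / (s + 1) * ((√X) ^ (-(2 * s)) / (2 * s) - (√X) ^ (-(2 * s + 1))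
          - X ^ (-(2 * s)) / (2 * s)) := by field_simp
      _ ≤ _ := by gcongr
  rw [abs_le] at step ⊢
  constructor <;> linarith [step.1, step.2]


/-- For an integer `k ≥ 3` there is a constant `C` (depending only on `k`) such
that for all real `X ≥ 1`,
`|∑_{√X < b < X} ∑_{1 ≤ a < X/b} (a/b)^{(k−1)/2} − 2X/((k+1)(k−1))| ≤ C·√X`. -/
theorem large_b_sum_estimate (k : ℕ) (hk : 3 ≤ k) :
    ∃ C : ℝ, ∀ X : ℝ, 1 ≤ X →
      |(∑ b ∈ (Finset.Ico 1 ⌈X⌉₊).filter (fun b : ℕ => Real.sqrt X < (b : ℝ)),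
            ∑ a ∈ Finset.Ico 1 ⌈X / (b : ℝ)⌉₊,
              ((a : ℝ) / (b : ℝ)) ^ (((k : ℝ) - 1) / 2))
          - 2 * X / (((k : ℝ) + 1) * ((k : ℝ) - 1))| ≤ C * Real.sqrt X := by

  refine ⟨4, fun X hX => ?_⟩
  have hk' : (3 : ℝ) ≤ k := by exact_mod_cast hk
  have h := mainS (s := ((k : ℝ) - 1) / 2) (by linarith) hX
  have e : X / (2 * (((k : ℝ) - 1) / 2) * (((k : ℝ) - 1) / 2 + 1)) =
      2 * X / (((k : ℝ) + 1) * ((k : ℝ) - 1)) := by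
    have h1 : (k : ℝ) - 1 ≠ 0 := by linarith
    have h2 : (k : ℝ) + 1 ≠ 0 := by linarith
    rw [show 2 * (((k : ℝ) - 1) / 2) * (((k : ℝ) - 1) / 2 + 1) =
      ((k : ℝ) + 1) * ((k : ℝ) - 1) / 2 by ring]
    field_simp
  rw [e] at h
  exact h
end

section
/- Let k ≥ 3 be an integer. Then lim_{X→∞} (1/X) · ( −(1/2)·∑_{1 ≤ n < X} ∑_{d | n} min(d/√n, √n/d)^{k−1} ) = 1/(1−k). In particular the average over n of the hyperbolic-plus-unipotent contribution to the Selberg trace formula has the nonzero limit 1/(1−k). -/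
open Filter Topology

lemma pow_step_upper (j : ℕ) (x : ℝ) (hx : 0 ≤ x) :
    (x+1)^(j+1) ≤ x^(j+1) + (j+1) * (x+1)^j := by
  induction j with
  | zero => simp
  | succ j ih =>
    have h1 : x^(j+1) ≤ (x+1)^(j+1) := by gcongr; linarith
    have h2 := mul_le_mul_of_nonneg_left ih (by linarith : 0 ≤ x+1)
    push_cast
    calc (x+1)^(j+1+1) = (x+1) * (x+1)^(j+1) := by ring
      _ ≤ _ := h2
      _ = x^(j+1+1) + x^(j+1) + (j+1) * (x+1)^(j+1) := by ring
      _ ≤ _ := by linarith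

lemma pow_step_lower (j : ℕ) (x : ℝ) (hx : 0 ≤ x) :
    x^(j+1) + (j+1) * x^j ≤ (x+1)^(j+1) := by
  induction j with
  | zero => simp
  | succ j ih =>
    have h1 : 0 ≤ x^j := by positivity
    have h2 := mul_le_mul_of_nonneg_left ih (by linarith : 0 ≤ x+1)
    push_cast
    have h3 : 0 ≤ (j+1:ℝ) * x^j := by positivity
    calc _ ≤ (x+1) * (x ^ (j + 1) + (↑j + 1) * x ^ j) := by
            rw [pow_succ x (j+1), pow_succ x j]; linarith
      _ ≤ _ := h2
      _ = _ := by ring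

lemma psum_bounds (j M : ℕ) :
    (M:ℝ)^(j+1) ≤ (j+1) * ∑ a ∈ Finset.Icc 1 M, (a:ℝ)^j ∧
    (j+1) * ∑ a ∈ Finset.Icc 1 M, (a:ℝ)^j ≤ (M:ℝ)^(j+1) + (j+1) * (M:ℝ)^j := by
  induction M with
  | zero => simp; positivity
  | succ M ih =>
    rw [Finset.sum_Icc_succ_top (by omega)]
    have h1 := pow_step_upper j M (by positivity)
    have h2 := pow_step_lower j M (by positivity)
    push_cast
    constructor <;> rw [mul_add] <;> linarith [ih.1, ih.2]

lemma psum_tendsto (j : ℕ) :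
    Tendsto (fun M : ℕ => (∑ a ∈ Finset.Icc 1 M, (a:ℝ)^j) / (M:ℝ)^(j+1)) atTop
      (𝓝 (1 / ((j:ℝ)+1))) := by
  have hl : Tendsto (fun M : ℕ => 1 / ((j:ℝ)+1) + 1 / (M:ℝ)) atTop (𝓝 (1 / ((j:ℝ)+1) + 0)) :=
    tendsto_const_nhds.add tendsto_one_div_atTop_nhds_zero_nat
  rw [add_zero] at hl
  refine tendsto_of_tendsto_of_tendsto_of_le_of_le' tendsto_const_nhds hl ?_ ?_
  all_goals
    filter_upwards [eventually_gt_atTop 0] with M hM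
    have hM' : (0:ℝ) < M := by exact_mod_cast hM
    have := psum_bounds j M
  · rw [div_le_div_iff₀ (by positivity) (by positivity)]
    linarith [this.1]
  · rw [div_le_iff₀ (by positivity)]
    have h : (1 / ((j:ℝ)+1) + 1 / (M:ℝ)) * (M:ℝ)^(j+1) =
      ((M:ℝ)^(j+1) + (j+1) * (M:ℝ)^j) / (j+1) := by field_simp; ring
    rw [h, le_div_iff₀ (by positivity)]
    linarith [this.2]

lemma sqrt_ratio : Tendsto (fun N : ℕ => (Nat.sqrt N : ℝ) / √(N:ℝ)) atTop (𝓝 1) := by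
  have h := (tendsto_nat_floor_div_atTop (R := ℝ)).comp
    (Real.tendsto_sqrt_atTop.comp tendsto_natCast_atTop_atTop)
  refine h.congr fun N => ?_
  simp [Real.floor_real_sqrt_eq_nat_sqrt]

lemma natsqrt_tendsto : Tendsto Nat.sqrt atTop atTop := by
  refine tendsto_atTop.2 fun b => ?_
  filter_upwards [eventually_ge_atTop (b*b)] with n hn
  exact Nat.le_sqrt.2 hn

lemma psum_tendsto' (j : ℕ) :
    Tendsto (fun N : ℕ => (∑ a ∈ Finset.Icc 1 (Nat.sqrt N), (a:ℝ)^j) / √(N:ℝ)^(j+1)) atTop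
      (𝓝 (1 / ((j:ℝ)+1))) := by
  have h := ((psum_tendsto j).comp natsqrt_tendsto).mul (sqrt_ratio.pow (j+1))
  rw [one_pow, mul_one] at h
  refine h.congr' ?_
  filter_upwards [eventually_gt_atTop 0] with N hN
  have h1 : (0:ℝ) < Nat.sqrt N := by exact_mod_cast Nat.sqrt_pos.2 hN
  have h2 : (0:ℝ) < √(N:ℝ) := Real.sqrt_pos.2 (by exact_mod_cast hN)
  simp only [Function.comp, div_pow]
  field_simp

noncomputable def cc (m n : ℕ) : ℝ := ∑ d ∈ n.divisors with d * d ≤ n, (d:ℝ)^m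
noncomputable def AA (m N : ℕ) : ℝ := ∑ n ∈ Finset.range (N+1), cc m n

lemma AA_eq (m N : ℕ) : AA m N =
    ∑ a ∈ Finset.Icc 1 (Nat.sqrt N), ∑ b ∈ Finset.Icc a (N / a), (a:ℝ)^m := by
  unfold AA cc
  rw [Finset.sum_sigma', Finset.sum_sigma']
  refine Finset.sum_bij' (fun x _ => ⟨x.2, x.1 / x.2⟩) (fun x _ => ⟨x.1 * x.2, x.1⟩) ?_ ?_ ?_ ?_ ?_
  · rintro ⟨n, d⟩ h
    simp only [Finset.mem_sigma, Finset.mem_range, Finset.mem_filter, Nat.mem_divisors,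
      Finset.mem_Icc] at h ⊢
    obtain ⟨h1, ⟨⟨e, rfl⟩, h3⟩, h4⟩ := h
    have hd : 0 < d := Nat.pos_of_ne_zero (by rintro rfl; simp at h3)
    rw [Nat.mul_div_cancel_left _ hd]
    refine ⟨⟨hd, Nat.le_sqrt.2 (by omega)⟩, Nat.le_of_mul_le_mul_left h4 hd, ?_⟩
    rw [Nat.le_div_iff_mul_le hd, mul_comm]; omega
  · rintro ⟨a, b⟩ h
    simp only [Finset.mem_sigma, Finset.mem_range, Finset.mem_filter, Nat.mem_divisors,
      Finset.mem_Icc] at h ⊢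
    obtain ⟨⟨h1, h2⟩, h3, h4⟩ := h
    rw [Nat.le_div_iff_mul_le h1, mul_comm] at h4
    refine ⟨by omega, ⟨Dvd.intro _ rfl, ?_⟩, Nat.mul_le_mul_left _ h3⟩
    have : 0 < a * b := Nat.mul_pos h1 (by omega)
    omega
  · rintro ⟨n, d⟩ h
    simp only [Finset.mem_sigma, Finset.mem_range, Finset.mem_filter, Nat.mem_divisors,
      Finset.mem_Icc] at h ⊢
    simp [Nat.mul_div_cancel' h.2.1.1]
  · rintro ⟨a, b⟩ h
    simp only [Finset.mem_sigma, Finset.mem_Icc] at h ⊢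
    simp [Nat.mul_div_cancel_left _ (show 0 < a by omega)]
  · rintro ⟨n, d⟩ h
    rfl

lemma AA_bounds (m N : ℕ) (hm : 1 ≤ m) :
    (N:ℝ) * ∑ a ∈ Finset.Icc 1 (Nat.sqrt N), (a:ℝ)^(m-1)
      - ∑ a ∈ Finset.Icc 1 (Nat.sqrt N), (a:ℝ)^(m+1) ≤ AA m N ∧
    AA m N ≤ (N:ℝ) * ∑ a ∈ Finset.Icc 1 (Nat.sqrt N), (a:ℝ)^(m-1)
      - ∑ a ∈ Finset.Icc 1 (Nat.sqrt N), (a:ℝ)^(m+1)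
      + ∑ a ∈ Finset.Icc 1 (Nat.sqrt N), (a:ℝ)^m := by
  obtain ⟨p, rfl⟩ : ∃ p, m = p + 1 := ⟨m-1, by omega⟩
  rw [AA_eq, Finset.mul_sum, ← Finset.sum_sub_distrib, ← Finset.sum_add_distrib]
  constructor <;>
  · refine Finset.sum_le_sum fun a ha => ?_
    rw [Finset.mem_Icc] at ha
    have ha0 : (0:ℝ) < a := by exact_mod_cast ha.1
    have h1 : a ≤ N / a := by
      rw [Nat.le_div_iff_mul_le ha.1]; exact Nat.le_sqrt.1 ha.2
    have h2 : ((N / a : ℕ) : ℝ) ≤ N / a := Nat.cast_div_le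
    have h3 : (N:ℝ)/a ≤ ((N / a : ℕ) : ℝ) + 1 := by
      rw [div_le_iff₀ ha0]
      have := Nat.lt_mul_div_succ N ha.1
      have h' : N ≤ (N/a + 1) * a := by rw [mul_comm]; exact this.le
      exact_mod_cast h'
    rw [Finset.sum_const, Nat.card_Icc, nsmul_eq_mul, Nat.cast_sub (by omega)]
    push_cast
    have h4 : (N:ℝ) * a^p = (N/a) * a^(p+1) := by
      rw [pow_succ]; field_simp
    have h5 : (0:ℝ) < (a:ℝ)^(p+1) := by positivity
    rw [h4, pow_succ _ (p+1)]
    nlinarith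

lemma AA_tendsto (m : ℕ) (hm : 1 ≤ m) :
    Tendsto (fun N : ℕ => AA m N / √(N:ℝ)^(m+2)) atTop
      (𝓝 (1 / (m:ℝ) - 1 / ((m:ℝ)+2))) := by
  obtain ⟨p, rfl⟩ : ∃ p, m = p + 1 := ⟨m-1, by omega⟩
  have t1 := psum_tendsto' p
  have t2 := psum_tendsto' (p+2)
  have t3 := psum_tendsto' (p+1)
  have t4 : Tendsto (fun N : ℕ => 1 / √(N:ℝ)) atTop (𝓝 0) :=
    (Real.tendsto_sqrt_atTop.comp tendsto_natCast_atTop_atTop).const_div_atTop 1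
  have e1 := t1.sub t2
  have e2 := e1.add (t3.mul t4)
  rw [mul_zero, add_zero] at e2
  have hc : (1 / (p + 1:ℝ) - 1 / (((p+2:ℕ):ℝ) + 1)) =
    1 / ((p+1:ℕ):ℝ) - 1 / (((p+1:ℕ):ℝ)+2) := by push_cast; ring_nf
  rw [hc] at e1 e2
  refine tendsto_of_tendsto_of_tendsto_of_le_of_le' e1 e2 ?_ ?_
  all_goals
    filter_upwards [eventually_gt_atTop 0] with N hN
    have hN' : (0:ℝ) < N := by exact_mod_cast hN
    have hy : (0:ℝ) < √(N:ℝ) := Real.sqrt_pos.2 hN'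
    have hyy : (N:ℝ) = √(N:ℝ)^2 := (Real.sq_sqrt hN'.le).symm
    have := AA_bounds (p+1) N (by omega)
    rw [hyy] at this
    simp only [Nat.add_sub_cancel, Real.sqrt_sq hy.le] at this
  · rw [le_div_iff₀ (by positivity)]
    refine le_trans (le_of_eq ?_) this.1
    field_simp
    ring
  · rw [div_le_iff₀ (by positivity)]
    refine le_trans this.2 (le_of_eq ?_)
    field_simp
    ring

lemma abel_sum (c w : ℕ → ℝ) (h0 : c 0 = 0) (N : ℕ) :
    ∑ i ∈ Finset.range (N+1), c i * w i = (∑ i ∈ Finset.range (N+1), c i) * w N +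
      ∑ n ∈ Finset.range N, (∑ i ∈ Finset.range (n+1), c i) * (w n - w (n+1)) := by
  induction N with
  | zero => simp
  | succ N ih =>
    rw [Finset.sum_range_succ, ih, Finset.sum_range_succ c (N+1),
      Finset.sum_range_succ (fun n => (∑ i ∈ Finset.range (n+1), c i) * (w n - w (n+1))) N]
    ring

lemma w_tendsto (m : ℕ) :
    Tendsto (fun n : ℕ => (n:ℝ) * (1 - (√(n:ℝ) / √((n:ℝ)+1))^m)) atTop (𝓝 ((m:ℝ)/2)) := by
  have h1 : Tendsto (fun n : ℕ => (n:ℝ) / ((n:ℝ)+1)) atTop (𝓝 1) :=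
    tendsto_natCast_div_add_atTop 1
  have h2 : Tendsto (fun n : ℕ => √(n:ℝ) / √((n:ℝ)+1)) atTop (𝓝 1) := by
    have := (Real.continuous_sqrt.tendsto 1).comp h1
    rw [Real.sqrt_one] at this
    refine this.congr fun n => ?_
    simp
  have h3 : Tendsto (fun n : ℕ => ∑ i ∈ Finset.range m, (√(n:ℝ) / √((n:ℝ)+1))^i) atTop
      (𝓝 (∑ i ∈ Finset.range m, 1^i)) :=
    tendsto_finsetSum _ fun i _ => h2.pow i
  have h4 := (h1.mul h3).div (h2.const_add 1) (by norm_num)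
  simp only [one_pow, Finset.sum_const, Finset.card_range, nsmul_eq_mul, mul_one, one_mul] at h4
  norm_num at h4
  refine h4.congr fun n => ?_
  simp only [Pi.div_apply]
  have hq : (√(n:ℝ) / √((n:ℝ)+1))^2 = n / (n+1) := by
    rw [div_pow, Real.sq_sqrt (by positivity), Real.sq_sqrt (by positivity)]
  have hq0 : 0 ≤ √(n:ℝ) / √((n:ℝ)+1) := by positivity
  generalize √(n:ℝ) / √((n:ℝ)+1) = q at *
  have hg := geom_sum_mul q m
  have : (n:ℝ) / (n+1) = n * (1 - q^2) := by rw [hq]; field_simp; ring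
  rw [this, div_eq_iff (by positivity)]
  linear_combination (-(n:ℝ) * (1+q)) * hg

lemma main_tendsto (m : ℕ) (hm : 1 ≤ m) :
    Tendsto (fun N : ℕ => (∑ i ∈ Finset.range (N+1), cc m i * (1 / √(i:ℝ)^m)) / N) atTop
      (𝓝 (1 / (m:ℝ))) := by
  have hA := AA_tendsto m hm
  have hc := (hA.mul (w_tendsto m)).cesaro
  have := hA.add hc
  have hm' : (0:ℝ) < m := by exact_mod_cast hm
  have he : (1 / (m:ℝ) - 1 / ((m:ℝ)+2)) + (1 / (m:ℝ) - 1 / ((m:ℝ)+2)) * (m/2) = 1 / m := by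
    field_simp; ring
  rw [he] at this
  refine this.congr' ?_
  filter_upwards [eventually_gt_atTop 0] with N hN
  rw [abel_sum _ _ (by simp [cc])]
  have hN' : (0:ℝ) < N := by exact_mod_cast hN
  have hy : (0:ℝ) < √(N:ℝ) := Real.sqrt_pos.2 hN'
  have hyy : √(N:ℝ)^2 = (N:ℝ) := (Real.sq_sqrt hN'.le)
  rw [add_div]
  congr 1
  · rw [pow_add, hyy]; unfold AA; field_simp
  · rw [div_eq_inv_mul]
    congr 1
    refine Finset.sum_congr rfl fun n _ => ?_
    rcases Nat.eq_zero_or_pos n with rfl | hn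
    · simp [AA, cc]
    have hn' : (0:ℝ) < n := by exact_mod_cast hn
    have hy : (0:ℝ) < √(n:ℝ) := Real.sqrt_pos.2 hn'
    have hz : (0:ℝ) < √(n+1:ℝ) := Real.sqrt_pos.2 (by linarith)
    have hyy : √(n:ℝ)^2 = (n:ℝ) := (Real.sq_sqrt hn'.le)
    rw [pow_add, hyy]; unfold AA; push_cast
    rw [div_pow]
    field_simp

lemma sum_div (m n : ℕ) (hn : 0 < n) :
    ∑ d ∈ n.divisors, (min ((d : ℝ) / √n) (√n / d)) ^ m
     = 2 * (cc m n * (1 / √(n:ℝ)^m)) - if IsSquare n then 1 else 0 := by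
  have hn' : (0:ℝ) < n := by exact_mod_cast hn
  have hy : (0:ℝ) < √(n:ℝ) := Real.sqrt_pos.2 hn'
  have hyy : √(n:ℝ)*√(n:ℝ) = (n:ℝ) := (Real.mul_self_sqrt hn'.le)
  have key : ∀ d ∈ n.divisors, (min ((d : ℝ) / √n) (√n / d)) ^ m =
      (if d * d ≤ n then (d:ℝ)^m / √n^m else 0) +
      (if (n/d) * (n/d) ≤ n then ((n/d:ℕ):ℝ)^m / √n^m else 0) - (if d * d = n then 1 else 0) := by
    intro d hd
    obtain ⟨⟨e, rfl⟩, -⟩ := Nat.mem_divisors.1 hd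
    have hd0 : 0 < d := Nat.pos_of_ne_zero (by rintro rfl; simp at hn)
    have he0 : 0 < e := Nat.pos_of_ne_zero (by rintro rfl; simp at hn)
    rw [Nat.mul_div_cancel_left _ hd0]
    have hd' : (0:ℝ) < d := by exact_mod_cast hd0
    have he' : (0:ℝ) < e := by exact_mod_cast he0
    have hs : √((d*e:ℕ):ℝ) / d = e / √((d*e:ℕ):ℝ) := by
      rw [div_eq_div_iff hd'.ne' hy.ne', hyy]; push_cast; ring
    rw [hs]
    rcases lt_trichotomy d e with h | h | h
    · have h1 : d * d < d * e := Nat.mul_lt_mul_of_pos_left h hd0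
      have h2 : d * e < e * e := Nat.mul_lt_mul_of_pos_right h he0
      have h3 : (d:ℝ) ≤ e := by exact_mod_cast h.le
      rw [if_pos h1.le, if_neg (by omega), if_neg (by omega), min_eq_left (by gcongr), div_pow]
      ring
    · subst h
      have : √((d*d:ℕ):ℝ) = d := by push_cast; exact Real.sqrt_mul_self hd'.le
      rw [this]; simp [hd'.ne']
    · have h1 : e * e < d * e := Nat.mul_lt_mul_of_pos_right h he0
      have h2 : d * e < d * d := Nat.mul_lt_mul_of_pos_left h hd0
      have h3 : (e:ℝ) ≤ d := by exact_mod_cast h.le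
      rw [if_neg (by omega), if_pos h1.le, if_neg (by omega), min_eq_right (by gcongr), div_pow]
      ring
  rw [Finset.sum_congr rfl key, Finset.sum_sub_distrib, Finset.sum_add_distrib,
    Nat.sum_div_divisors n (fun d => if d * d ≤ n then (d:ℝ)^m / √n^m else 0)]
  have h1 : ∑ d ∈ n.divisors, (if d * d ≤ n then (d:ℝ)^m / √n^m else 0) =
      cc m n * (1 / √(n:ℝ)^m) := by
    unfold cc
    rw [← Finset.sum_filter, Finset.sum_mul]
    simp [div_eq_mul_inv]
  have h2 : ∑ d ∈ n.divisors, (if d * d = n then (1:ℝ) else 0) =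
      if IsSquare n then 1 else 0 := by
    split_ifs with h
    · obtain ⟨r, rfl⟩ := h
      rw [Finset.sum_eq_single r]
      · simp
      · intro b _ hb
        rw [if_neg]
        intro h; exact hb (Nat.mul_self_inj.1 h)
      · intro h; exfalso; apply h
        rw [Nat.mem_divisors]; exact ⟨Dvd.intro _ rfl, hn.ne'⟩
    · refine Finset.sum_eq_zero fun d _ => if_neg ?_
      intro h'; exact h ⟨d, h'.symm⟩
  rw [h1, h2]; ring

lemma sq_tendsto : Tendsto (fun N : ℕ =>
    (∑ n ∈ Finset.range (N+1), if IsSquare n then (1:ℝ) else 0) / N) atTop (𝓝 0) := by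
  have t4 : Tendsto (fun N : ℕ => 1 / √(N:ℝ)) atTop (𝓝 0) :=
    (Real.tendsto_sqrt_atTop.comp tendsto_natCast_atTop_atTop).const_div_atTop 1
  have t5 := t4.add (tendsto_one_div_atTop_nhds_zero_nat (𝕜 := ℝ))
  rw [add_zero] at t5
  refine squeeze_zero' (Eventually.of_forall fun N => by positivity) ?_ t5
  filter_upwards [eventually_gt_atTop 0] with N hN
  have hN' : (0:ℝ) < N := by exact_mod_cast hN
  have hy : (0:ℝ) < √(N:ℝ) := Real.sqrt_pos.2 hN'
  have hyy : √(N:ℝ)*√(N:ℝ) = (N:ℝ) := (Real.mul_self_sqrt hN'.le)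
  have hle : (∑ n ∈ Finset.range (N+1), if IsSquare n then (1:ℝ) else 0) ≤ Nat.sqrt N + 1 := by
    rw [← Finset.sum_filter, Finset.sum_const, nsmul_eq_mul, mul_one]
    have : (Finset.range (N+1)).filter (fun n => IsSquare n) ⊆
        (Finset.range (Nat.sqrt N + 1)).image (fun r => r * r) := by
      intro n hn
      simp only [Finset.mem_filter, Finset.mem_range, Finset.mem_image] at hn ⊢
      obtain ⟨h1, r, rfl⟩ := hn
      exact ⟨r, Nat.lt_succ_of_le (Nat.le_sqrt.2 (by omega)), rfl⟩
    have h := (Finset.card_le_card this).trans Finset.card_image_le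
    rw [Finset.card_range] at h
    exact_mod_cast h
  have h2 : (Nat.sqrt N : ℝ) ≤ √N := Real.nat_sqrt_le_real_sqrt
  have h3 : 1 / √(N:ℝ) = √N / N := by rw [div_eq_div_iff hy.ne' hN'.ne', hyy, one_mul]
  rw [h3, ← add_div]
  gcongr
  linarith

/-- For an integer `k ≥ 3`, the average over `n < X` of the hyperbolic-plus-unipotent
contribution to the Selberg trace formula tends to the nonzero limit `1/(1−k)`:
`lim_{X→∞} (1/X)·(−(1/2)·∑_{1 ≤ n < X} ∑_{d ∣ n} min(d/√n, √n/d)^{k−1}) = 1/(1−k)`. -/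
theorem hyperbolic_unipotent_average_limit (k : ℕ) (hk : 3 ≤ k) :
    Filter.Tendsto
      (fun X : ℝ => (1 / X) *
        (-(1/2) * ∑ n ∈ Finset.Ico 1 ⌈X⌉₊, ∑ d ∈ n.divisors,
            (min ((d : ℝ) / Real.sqrt n) (Real.sqrt n / d)) ^ (k - 1)))
      Filter.atTop (nhds (1 / (1 - (k : ℝ)))) := by
  obtain ⟨m, rfl⟩ : ∃ m, k = m + 1 := ⟨k-1, by omega⟩
  rw [Nat.add_sub_cancel]
  set f : ℕ → ℝ := fun n => ∑ d ∈ n.divisors, (min ((d : ℝ) / √n) (√n / d)) ^ m with hf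
  have h1 : Tendsto (fun N : ℕ => (∑ n ∈ Finset.Ico 1 (N+1), f n) / N) atTop (𝓝 (2 * (1/m))) := by
    have := ((main_tendsto m (by omega)).const_mul 2).sub sq_tendsto
    have := this.add ((tendsto_one_div_atTop_nhds_zero_nat (𝕜 := ℝ)))
    rw [sub_zero, add_zero] at this
    refine this.congr fun N => ?_
    rw [Finset.sum_congr rfl fun n hn => sum_div m n (Finset.mem_Ico.1 hn).1,
      Finset.sum_sub_distrib, ← Finset.mul_sum,
      Finset.range_eq_Ico, Finset.sum_eq_sum_Ico_succ_bot (by omega),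
      Finset.sum_eq_sum_Ico_succ_bot (by omega : 0 < N+1)]
    simp [cc]
    ring
  have h2 : Tendsto (fun N : ℕ => (∑ n ∈ Finset.Ico 1 N, f n) / N) atTop (𝓝 (2 * (1/m))) := by
    rw [← tendsto_add_atTop_iff_nat 1]
    have := h1.mul (tendsto_natCast_div_add_atTop (1:ℝ))
    rw [mul_one] at this
    refine this.congr' ?_
    filter_upwards [eventually_gt_atTop 0] with N hN
    have hN' : (0:ℝ) < N := by exact_mod_cast hN
    push_cast
    field_simp
  have h3 := ((h2.comp (tendsto_nat_ceil_atTop (α := ℝ))).mul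
    (tendsto_nat_ceil_div_atTop (R := ℝ))).const_mul (-(1/2))
  have hm : (0:ℝ) < m := by exact_mod_cast (by omega : 0 < m)
  have hl : -(1/2) * (2 * (1 / (m:ℝ)) * 1) = 1 / (1 - ((m+1:ℕ):ℝ)) := by
    push_cast
    rw [show (1 - ((m:ℝ)+1)) = -m by ring, div_neg]; ring
  rw [hl] at h3
  refine h3.congr' ?_
  filter_upwards [eventually_gt_atTop 0] with X hX
  have hc : (0:ℝ) < ⌈X⌉₊ := by exact_mod_cast Nat.ceil_pos.2 hX
  simp only [Function.comp]
  field_simp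
end

section
/- Let s, z ∈ ℂ with Re(s) > 1 and Re(z) > 1. Then the series ∑_{n=1}^{∞} n^{−s} · ∏_{p | n, p prime} (1 − p^{−z(v_p(n)+1)})/(1 − p^{−z}) converges absolutely and equals ζ(s)·ζ(s+z), where ζ is the Riemann zeta function. -/
open ArithmeticFunction in
/-- The arithmetic function `n ↦ n^(-z)`. -/
noncomputable def auxP (z : ℂ) : ArithmeticFunction ℂ :=
  ⟨fun n => if n = 0 then 0 else (n : ℂ) ^ (-z), by simp⟩

lemma auxP_apply (z : ℂ) {n : ℕ} (hn : n ≠ 0) : auxP z n = (n : ℂ) ^ (-z) := by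
  change (if n = 0 then 0 else (n : ℂ) ^ (-z)) = _
  simp [hn]

lemma auxP_mult (z : ℂ) : (auxP z).IsMultiplicative := by
  rw [ArithmeticFunction.IsMultiplicative.iff_ne_zero]
  refine ⟨by simp [auxP_apply], ?_⟩
  intro m n hm hn _
  rw [auxP_apply z hm, auxP_apply z hn, auxP_apply z (mul_ne_zero hm hn), Nat.cast_mul,
    Complex.natCast_mul_natCast_cpow]

lemma auxP_term (s z : ℂ) : LSeries.term (auxP z) s = LSeries.term 1 (s + z) := by
  funext n
  rcases eq_or_ne n 0 with rfl | hn
  · simp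
  · have h : (n : ℂ) ≠ 0 := by exact_mod_cast hn
    rw [LSeries.term_of_ne_zero hn, LSeries.term_of_ne_zero hn, auxP_apply z hn,
      Complex.cpow_add _ _ h, Complex.cpow_neg]
    simp only [Pi.one_apply]
    field_simp

lemma aux_prime_pow (z : ℂ) (hz : 1 < z.re) {p k : ℕ} (hp : p.Prime) :
    ((ArithmeticFunction.zeta : ArithmeticFunction ℂ) * auxP z) (p ^ k) =
      (1 - (p : ℂ) ^ (-z * ((k : ℂ) + 1))) / (1 - (p : ℂ) ^ (-z)) := by
  have h0 : (p : ℂ) ≠ 0 := by exact_mod_cast hp.ne_zero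
  have h1 : (p : ℂ) ^ (-z) ≠ 1 := by
    intro h
    have h2 : ‖(p : ℂ) ^ (-z)‖ < 1 := by
      rw [Complex.norm_natCast_cpow_of_pos hp.pos]
      apply Real.rpow_lt_one_of_one_lt_of_neg
      · exact_mod_cast hp.one_lt
      · simp; linarith
    rw [h] at h2
    simp at h2
  rw [ArithmeticFunction.coe_zeta_mul_apply, Nat.sum_divisors_prime_pow hp]
  have : ∀ i ∈ Finset.range (k + 1), auxP z (p ^ i) = ((p : ℂ) ^ (-z)) ^ i := by
    intro i _
    rw [auxP_apply z (pow_ne_zero _ hp.ne_zero), Nat.cast_pow, ← Complex.cpow_nat_mul,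
      ← Complex.natCast_cpow_natCast_mul]
  rw [Finset.sum_congr rfl this, geom_sum_eq h1]
  have e : (p : ℂ) ^ (-z * ((k : ℂ) + 1)) = ((p : ℂ) ^ (-z)) ^ (k + 1) := by
    rw [← Complex.cpow_nat_mul, mul_comm]; push_cast; rfl
  rw [e, ← neg_div_neg_eq, neg_sub, neg_sub]

/-- For `s, z ∈ ℂ` with `Re(s) > 1` and `Re(z) > 1`, the series
`∑_{n ≥ 1} n^{−s} · ∏_{p ∣ n} (1 − p^{−z(v_p(n)+1)})/(1 − p^{−z})` converges
absolutely and equals `ζ(s)·ζ(s+z)`. -/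
theorem zeta_product_identity (s z : ℂ) (hs : 1 < s.re) (hz : 1 < z.re) :
    let f : ℕ → ℂ := fun n => (n : ℂ) ^ (-s) *
      ∏ p ∈ n.primeFactors,
        (1 - (p : ℂ) ^ (-z * ((n.factorization p : ℂ) + 1))) / (1 - (p : ℂ) ^ (-z))
    (Summable (fun n : ℕ => ‖f (n + 1)‖) ∧
      ∑' n : ℕ, f (n + 1) = riemannZeta s * riemannZeta (s + z)) := by
  intro f
  have hsz : 1 < (s + z).re := by simp; linarith
  have hP : LSeriesHasSum (auxP z) s (riemannZeta (s + z)) := by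
    have := LSeriesHasSum_one hsz
    unfold LSeriesHasSum at this ⊢
    rwa [auxP_term]
  have hZ : LSeriesHasSum (fun n => (ArithmeticFunction.zeta : ArithmeticFunction ℂ) n) s
      (riemannZeta s) := by
    simpa using ArithmeticFunction.LSeriesHasSum_zeta hs
  have hM := ArithmeticFunction.LSeriesHasSum_mul hZ hP
  have hmult : ((ArithmeticFunction.zeta : ArithmeticFunction ℂ) * auxP z).IsMultiplicative :=
    (ArithmeticFunction.isMultiplicative_zeta.natCast).mul (auxP_mult z)
  have key : ∀ n : ℕ, f (n + 1) = LSeries.term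
      (fun n => ((ArithmeticFunction.zeta : ArithmeticFunction ℂ) * auxP z) n) s (n + 1) := by
    intro n
    rw [LSeries.term_of_ne_zero n.succ_ne_zero, hmult.multiplicative_factorization _ n.succ_ne_zero,
      div_eq_mul_inv, ← Complex.cpow_neg, mul_comm]
    simp only [f]
    congr 1
    rw [Finsupp.prod, Nat.support_factorization]
    exact Finset.prod_congr rfl fun p hp =>
      (aux_prime_pow z hz (Nat.prime_of_mem_primeFactors hp)).symm
  unfold LSeriesHasSum at hM
  have hM' := (hasSum_nat_add_iff' 1).mpr hM
  simp only [Finset.sum_range_one, LSeries.term_zero, sub_zero] at hM'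
  simp only [key]
  exact ⟨hM'.summable.norm, hM'.tsum_eq⟩
end
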